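/- Let s ≥ 1 and let θ = e^{1/s}. Then for each n ≥ 2, L(θ, 1/2) computations give: if θ = e^{2/k} with k ≥ 3 odd, L(e^{2/k}, (e^{2/k}+1)/2) = 0; while for k = 2s even, L(e^{1/s}, (e^{1/s}+1)/2) = 0. -/

import Mathlib

/-- Distance from a real number to the nearest integer. -/
noncomputable def distNearestInt (x : ℝ) : ℝ := |x - round x|

/-- The inhomogeneous approximation constant. -/
noncomputable def Lconst (θ φ : ℝ) : ℝ :=
  Filter.liminf (fun q : ℤ => |(q : ℝ)| * distNearestInt (q * θ - φ)) Filter.cofinite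

open Filter

/-- The sequence with `u 0 = a`, `u 1 = b` and `u (n + 2) = (2 n + 3) k u (n + 1) + u n`, the
recurrence of the Bessel polynomials evaluated at `k`. -/
def besselSeq {R : Type*} [CommRing R] (k a b : R) : ℕ → R
  | 0 => a
  | 1 => b
  | n + 2 => (2 * n + 3) * k * besselSeq k a b (n + 1) + besselSeq k a b n

/-- The integral `∫₀¹ (t (1 - t))ⁿ e^{x t} dt`, the remainder of the diagonal Padé approximation
of the exponential function, up to normalization. -/
noncomputable def padeIntegral (x : ℝ) (n : ℕ) : ℝ :=
  ∫ t in (0 : ℝ)..1, (t * (1 - t)) ^ n * Real.exp (x * t)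

theorem padeIntegral_nonneg (x : ℝ) (n : ℕ) : 0 ≤ padeIntegral x n := by
  refine intervalIntegral.integral_nonneg zero_le_one fun t ht => ?_
  have : 0 ≤ t * (1 - t) := mul_nonneg ht.1 (by linarith [ht.2])
  positivity

theorem intervalIntegrable_padeIntegrand (x : ℝ) (n : ℕ) :
    IntervalIntegrable (fun t : ℝ => (t * (1 - t)) ^ n * Real.exp (x * t))
      MeasureTheory.volume 0 1 :=
  Continuous.intervalIntegrable (by fun_prop) _ _

theorem hasDerivAt_exp_const_mul (x t : ℝ) :
    HasDerivAt (fun t : ℝ => Real.exp (x * t)) (Real.exp (x * t) * x) t := by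
  simpa using ((hasDerivAt_id t).const_mul x).exp

theorem hasDerivAt_mul_one_sub (t : ℝ) :
    HasDerivAt (fun t : ℝ => t * (1 - t)) (1 - 2 * t) t := by
  refine ((hasDerivAt_id t).mul ((hasDerivAt_id t).const_sub 1)).congr_deriv ?_
  simp only [id]
  ring

theorem mul_padeIntegral_zero (x : ℝ) : x * padeIntegral x 0 = Real.exp x - 1 := by
  have h := intervalIntegral.integral_eq_sub_of_hasDerivAt (a := 0) (b := 1)
    (fun t _ => hasDerivAt_exp_const_mul x t)
    (Continuous.intervalIntegrable (by fun_prop) _ _)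
  rw [intervalIntegral.integral_mul_const] at h
  simp only [padeIntegral, pow_zero, one_mul]
  simp only [mul_one, mul_zero, Real.exp_zero] at h
  linarith

theorem sq_mul_padeIntegral_one (x : ℝ) :
    x ^ 2 * padeIntegral x 1 = Real.exp x + 1 - 2 * padeIntegral x 0 := by
  have h := intervalIntegral.integral_eq_sub_of_hasDerivAt (a := 0) (b := 1)
    (f := fun t : ℝ => (x * (t * (1 - t)) - (1 - 2 * t)) * Real.exp (x * t))
    (f' := fun t : ℝ => x ^ 2 * ((t * (1 - t)) ^ 1 * Real.exp (x * t))
      + 2 * ((t * (1 - t)) ^ 0 * Real.exp (x * t)))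
    (fun t _ => by
      refine ((((hasDerivAt_mul_one_sub t).const_mul x).sub
        (((hasDerivAt_id t).const_mul 2).const_sub 1)).mul
        (hasDerivAt_exp_const_mul x t)).congr_deriv ?_
      simp
      ring)
    (Continuous.intervalIntegrable (by fun_prop) _ _)
  rw [intervalIntegral.integral_add ((intervalIntegrable_padeIntegrand x 1).const_mul _)
    ((intervalIntegrable_padeIntegrand x 0).const_mul _),
    intervalIntegral.integral_const_mul, intervalIntegral.integral_const_mul] at h
  simp only [mul_one, mul_zero, Real.exp_zero] at h
  unfold padeIntegral
  linarith

theorem sq_mul_padeIntegral_add_two (x : ℝ) (n : ℕ) :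
    x ^ 2 * padeIntegral x (n + 2) = (n + 2) * (n + 1) * padeIntegral x n
      - 2 * (n + 2) * (2 * n + 3) * padeIntegral x (n + 1) := by
  have h := intervalIntegral.integral_eq_sub_of_hasDerivAt (a := 0) (b := 1)
    (f := fun t : ℝ => (x * (t * (1 - t)) ^ (n + 2)
      - (n + 2) * ((t * (1 - t)) ^ (n + 1) * (1 - 2 * t))) * Real.exp (x * t))
    (f' := fun t : ℝ => x ^ 2 * ((t * (1 - t)) ^ (n + 2) * Real.exp (x * t))
      - (n + 2) * (n + 1) * ((t * (1 - t)) ^ n * Real.exp (x * t))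
      + 2 * (n + 2) * (2 * n + 3) * ((t * (1 - t)) ^ (n + 1) * Real.exp (x * t)))
    (fun t _ => by
      refine (((((hasDerivAt_mul_one_sub t).pow (n + 2)).const_mul x).sub
        ((((hasDerivAt_mul_one_sub t).pow (n + 1)).mul
          (((hasDerivAt_id t).const_mul 2).const_sub 1)).const_mul ((n : ℝ) + 2))).mul
        (hasDerivAt_exp_const_mul x t)).congr_deriv ?_
      simp
      ring)
    (Continuous.intervalIntegrable (by fun_prop) _ _)
  rw [intervalIntegral.integral_add (((intervalIntegrable_padeIntegrand x _).const_mul _).sub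
      ((intervalIntegrable_padeIntegrand x _).const_mul _))
      ((intervalIntegrable_padeIntegrand x _).const_mul _),
    intervalIntegral.integral_sub ((intervalIntegrable_padeIntegrand x _).const_mul _)
      ((intervalIntegrable_padeIntegrand x _).const_mul _),
    intervalIntegral.integral_const_mul, intervalIntegral.integral_const_mul,
    intervalIntegral.integral_const_mul] at h
  simp at h
  unfold padeIntegral
  linarith

theorem exp_mul_besselSeq_sub {k : ℝ} (hk : 0 < k) (n : ℕ) :
    Real.exp (2 / k) * besselSeq k 1 (k - 1) n - besselSeq k 1 (k + 1) n =
      (-1) ^ n * ((2 / k) ^ (n + 1) / n.factorial * padeIntegral (2 / k) n) := by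
  induction n using Nat.twoStepInduction with
  | zero =>
    have h := mul_padeIntegral_zero (2 / k)
    simp [besselSeq, h]
  | one =>
    have h₀ := mul_padeIntegral_zero (2 / k)
    have h₁ := sq_mul_padeIntegral_one (2 / k)
    have h₂ : 2 * padeIntegral (2 / k) 0 = k * (Real.exp (2 / k) - 1) := by
      rw [← h₀]; field_simp
    simp only [besselSeq, Nat.factorial_one, Nat.cast_one, div_one, pow_one,
      Nat.reduceAdd]
    rw [h₁, h₂]
    ring
  | more n ih₀ ih₁ =>
    have h := sq_mul_padeIntegral_add_two (2 / k) n
    have e : Real.exp (2 / k) * besselSeq k 1 (k - 1) (n + 2) - besselSeq k 1 (k + 1) (n + 2) =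
        (2 * n + 3) * k * (Real.exp (2 / k) * besselSeq k 1 (k - 1) (n + 1)
          - besselSeq k 1 (k + 1) (n + 1))
        + (Real.exp (2 / k) * besselSeq k 1 (k - 1) n - besselSeq k 1 (k + 1) n) := by
      simp only [besselSeq]; ring
    have e' : (2 / k) ^ (n + 2 + 1) / ((n + 2).factorial : ℝ) * padeIntegral (2 / k) (n + 2) =
        (2 / k) ^ (n + 1) / ((n + 2).factorial : ℝ)
          * ((2 / k) ^ 2 * padeIntegral (2 / k) (n + 2)) := by ring
    rw [e, ih₀, ih₁, e', h, Nat.factorial_succ (n + 1), Nat.factorial_succ n]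
    push_cast
    have hn : (n.factorial : ℝ) ≠ 0 := by positivity
    have hn₁ : (n : ℝ) + 1 ≠ 0 := by positivity
    have hn₂ : (n : ℝ) + 1 + 1 ≠ 0 := by positivity
    have hk' := hk.ne'
    rw [pow_succ (2 / k) (n + 1)]
    field_simp
    ring

theorem besselSeq_intCast {k a b : ℤ} (n : ℕ) :
    ((besselSeq k a b n : ℤ) : ℝ) = besselSeq (k : ℝ) a b n := by
  induction n using Nat.twoStepInduction with
  | zero => rfl
  | one => rfl
  | more n ih₀ ih₁ => simp [besselSeq, ih₀, ih₁]

theorem besselSeq_det {R : Type*} [CommRing R] (k : R) (n : ℕ) :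
    besselSeq k 1 (k + 1) (n + 1) * besselSeq k 1 (k - 1) n
      - besselSeq k 1 (k + 1) n * besselSeq k 1 (k - 1) (n + 1) = (-1) ^ n * 2 := by
  induction n with
  | zero => simp [besselSeq]; ring
  | succ n ih =>
    simp only [besselSeq]
    rw [pow_succ]
    linear_combination -ih

theorem odd_besselSeq {k b : ℤ} (hb : Odd (b - k)) (m : ℕ) :
    Odd (besselSeq k 1 b (3 * m)) ∧ Odd (besselSeq k 1 b (3 * m + 1) - k) := by
  induction m with
  | zero => simpa [besselSeq] using hb
  | succ m ih =>
    obtain ⟨h₀, h₁⟩ := ih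
    rw [show 3 * (m + 1) = 3 * m + 3 by ring]
    simp only [besselSeq]
    push_cast
    generalize besselSeq k 1 b (3 * m) = u at *
    generalize besselSeq k 1 b (3 * m + 1) = v at *
    simp only [← Int.not_even_iff_odd] at *
    constructor <;> simp [Int.even_sub, Int.even_add, Int.even_mul,
      show ¬ Even (3 : ℤ) by decide, -Int.not_even_iff_odd] at * <;> tauto

theorem one_le_besselSeq {k b : ℤ} (hk : 0 ≤ k) (hb : 1 ≤ b) (n : ℕ) :
    1 ≤ besselSeq k 1 b n := by
  induction n using Nat.twoStepInduction with
  | zero => simp [besselSeq]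
  | one => simpa [besselSeq] using hb
  | more n ih₀ ih₁ =>
    simp only [besselSeq]
    have : 0 ≤ (2 * (n : ℤ) + 3) * k * besselSeq k 1 b (n + 1) := by positivity
    linarith

theorem le_besselSeq {k b : ℤ} (hk : 1 ≤ k) (hb : 1 ≤ b) (n : ℕ) :
    (n : ℤ) ≤ besselSeq k 1 b n := by
  match n with
  | 0 => simp [besselSeq]
  | 1 => simpa [besselSeq] using hb
  | n + 2 =>
    simp only [besselSeq]
    have h₀ := one_le_besselSeq (by lia : 0 ≤ k) hb n
    have h₁ := one_le_besselSeq (by lia : 0 ≤ k) hb (n + 1)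
    have h₂ : 1 ≤ k * besselSeq k 1 b (n + 1) := one_le_mul_of_one_le_of_one_le hk h₁
    push_cast
    nlinarith

theorem besselSeq_mul_abs_sub_le {k : ℤ} (hk : 2 ≤ k) (n : ℕ) :
    (n + 1 : ℝ) * (((besselSeq k 1 (k - 1) (n + 1) : ℤ) : ℝ) *
      |Real.exp (2 / k) * ((besselSeq k 1 (k - 1) (n + 1) : ℤ) : ℝ) -
        ((besselSeq k 1 (k + 1) (n + 1) : ℤ) : ℝ)|) ≤ 2 := by
  have hk₀ : (2 : ℝ) ≤ k := by exact_mod_cast hk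
  have hpos (m : ℕ) : (1 : ℝ) ≤ ((besselSeq k 1 (k - 1) m : ℤ) : ℝ) := by
    exact_mod_cast one_le_besselSeq (by lia) (by lia) m
  have hrec : ((besselSeq k 1 (k - 1) (n + 2) : ℤ) : ℝ) =
      (2 * n + 3) * k * ((besselSeq k 1 (k - 1) (n + 1) : ℤ) : ℝ)
        + ((besselSeq k 1 (k - 1) n : ℤ) : ℝ) := by
    simp only [besselSeq]; push_cast; rfl
  have hdet : ((besselSeq k 1 (k + 1) (n + 2) : ℤ) : ℝ) * ((besselSeq k 1 (k - 1) (n + 1) : ℤ) : ℝ)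
      - ((besselSeq k 1 (k + 1) (n + 1) : ℤ) : ℝ) * ((besselSeq k 1 (k - 1) (n + 2) : ℤ) : ℝ) =
        (-1) ^ (n + 1) * 2 := by
    exact_mod_cast besselSeq_det k (n + 1)
  have hrem (m : ℕ) : ∃ J : ℝ, 0 ≤ J ∧
      Real.exp (2 / k) * ((besselSeq k 1 (k - 1) m : ℤ) : ℝ) - ((besselSeq k 1 (k + 1) m : ℤ) : ℝ) =
        (-1) ^ m * J := by
    refine ⟨(2 / k) ^ (m + 1) / m.factorial * padeIntegral (2 / k) m, ?_, ?_⟩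
    · have := padeIntegral_nonneg (2 / k) m
      positivity
    · rw [besselSeq_intCast, besselSeq_intCast]
      push_cast
      exact exp_mul_besselSeq_sub (by linarith) m
  obtain ⟨J, hJ, hJe⟩ := hrem (n + 1)
  obtain ⟨J', hJ', hJe'⟩ := hrem (n + 2)
  have habs : |(-1 : ℝ) ^ (n + 1) * J| = J := by
    rw [abs_mul, abs_pow, abs_neg, abs_one, one_pow, one_mul, abs_of_nonneg hJ]
  rw [hJe, habs]
  have h₀ := hpos n
  have h₁ := hpos (n + 1)
  set q₀ := ((besselSeq k 1 (k - 1) n : ℤ) : ℝ)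
  set q₁ := ((besselSeq k 1 (k - 1) (n + 1) : ℤ) : ℝ)
  set q₂ := ((besselSeq k 1 (k - 1) (n + 2) : ℤ) : ℝ)
  have hsum : q₁ * J' + q₂ * J = 2 := by
    have hs : ((-1 : ℝ) ^ (n + 1)) ≠ 0 := by positivity
    apply mul_left_cancel₀ hs
    rw [pow_succ (-1 : ℝ) (n + 1)] at hJe'
    linear_combination hdet - q₂ * hJe + q₁ * hJe'
  have hle : (n + 1 : ℝ) * q₁ ≤ q₂ := by
    rw [hrec]
    have : (n + 1 : ℝ) ≤ (2 * n + 3) * k := by nlinarith [(Nat.cast_nonneg n : (0 : ℝ) ≤ n)]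
    nlinarith
  calc (n + 1 : ℝ) * (q₁ * J) = (n + 1) * q₁ * J := by ring
    _ ≤ q₂ * J := mul_le_mul_of_nonneg_right hle hJ
    _ ≤ 2 := by nlinarith

theorem distNearestInt_le (x : ℝ) (z : ℤ) : distNearestInt x ≤ |x - z| :=
  round_le x z

theorem frequently_mul_distNearestInt_le {k : ℤ} (hk : 2 ≤ k) {δ : ℝ} (hδ : 0 < δ) :
    ∃ᶠ q : ℤ in cofinite, |(q : ℝ)| * distNearestInt
      (q * Real.exp (2 / k) - (Real.exp (2 / k) + 1) / 2) ≤ δ := by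
  rw [frequently_cofinite_iff_infinite]
  refine Set.infinite_of_forall_exists_gt fun N => ?_
  obtain ⟨M, hM⟩ := exists_nat_gt (1 / δ)
  set m := M + N.natAbs + 1 with hm
  obtain ⟨a, ha⟩ := (odd_besselSeq (k := k) (b := k - 1) (by simp) m).1
  obtain ⟨b, hb⟩ := (odd_besselSeq (k := k) (b := k + 1) (by simp) m).1
  have hge := le_besselSeq (k := k) (b := k - 1) (by lia) (by lia) (3 * m)
  rw [ha] at hge
  refine ⟨a + 1, ?_, by lia⟩
  have hbound := besselSeq_mul_abs_sub_le hk (3 * m - 1)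
  rw [show 3 * m - 1 + 1 = 3 * m by lia, ha, hb] at hbound
  have hcast : ((3 * m - 1 : ℕ) : ℝ) + 1 = 3 * m := by
    rw [← Nat.cast_add_one, show 3 * m - 1 + 1 = 3 * m by lia]
    push_cast; rfl
  rw [hcast] at hbound
  push_cast at hbound
  have ha₀ : (0 : ℝ) ≤ a := by
    have : 0 ≤ a := by lia
    exact_mod_cast this
  have hmδ : 1 ≤ m * δ := by
    rw [div_lt_iff₀ hδ] at hM
    have : (M : ℝ) ≤ m := by exact_mod_cast (by lia : M ≤ m)
    nlinarith
  have hm₀ : (1 : ℝ) ≤ m := by exact_mod_cast (by lia : 1 ≤ m)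
  have hdist := distNearestInt_le
    (((a + 1 : ℤ) : ℝ) * Real.exp (2 / k) - (Real.exp (2 / k) + 1) / 2) b
  have heq : ((a + 1 : ℤ) : ℝ) * Real.exp (2 / k) - (Real.exp (2 / k) + 1) / 2 - b =
      (Real.exp (2 / k) * (2 * a + 1) - (2 * b + 1)) / 2 := by
    push_cast; ring
  rw [heq, abs_div, abs_two] at hdist
  set E := |Real.exp (2 / k) * (2 * a + 1) - (2 * b + 1)|
  have hE : 0 ≤ E := abs_nonneg _
  have habs : |((a + 1 : ℤ) : ℝ)| ≤ 2 * a + 1 := by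
    push_cast
    rw [abs_of_nonneg (by linarith)]
    linarith
  have hmul : (2 * a + 1) * E ≤ δ := by
    have : (m : ℝ) * ((2 * a + 1) * E) ≤ m * δ := by linarith
    exact le_of_mul_le_mul_left this (by linarith)
  calc _ ≤ (2 * a + 1) * (E / 2) :=
        mul_le_mul habs hdist (abs_nonneg _) (by linarith)
    _ ≤ δ := by nlinarith

theorem Lconst_exp_two_div {k : ℤ} (hk : 2 ≤ k) :
    Lconst (Real.exp (2 / k)) ((Real.exp (2 / k) + 1) / 2) = 0 := by
  have hnonneg : ∀ᶠ q : ℤ in cofinite, 0 ≤ |(q : ℝ)| * distNearestInt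
      (q * Real.exp (2 / k) - (Real.exp (2 / k) + 1) / 2) :=
    Eventually.of_forall fun q => mul_nonneg (abs_nonneg _) (abs_nonneg _)
  refine le_antisymm (le_of_forall_pos_le_add fun δ hδ => ?_) ?_
  · rw [zero_add]
    exact liminf_le_of_frequently_le (frequently_mul_distNearestInt_le hk hδ) ⟨0, hnonneg⟩
  · exact le_liminf_of_le
      (IsCoboundedUnder.of_frequently_le (frequently_mul_distNearestInt_le hk one_pos)) hnonneg

/-- For odd `k ≥ 3`, `L(e^{2/k}, (e^{2/k}+1)/2) = 0`; and for even `k = 2s`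
(`s ≥ 1`), `L(e^{1/s}, (e^{1/s}+1)/2) = 0`. -/
theorem Lconst_exp_half_theta_plus_one :
    (∀ k : ℕ, 3 ≤ k → Odd k →
      Lconst (Real.exp (2 / k)) ((Real.exp (2 / k) + 1) / 2) = 0) ∧
    (∀ s : ℕ, 1 ≤ s →
      Lconst (Real.exp (1 / s)) ((Real.exp (1 / s) + 1) / 2) = 0) := by
  refine ⟨fun k hk _ => ?_, fun s hs => ?_⟩
  · simpa using Lconst_exp_two_div (k := k) (by lia)
  · have h : (1 / s : ℝ) = 2 / ((2 * s : ℤ) : ℝ) := by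
      push_cast
      rw [← div_div, div_self two_ne_zero]
    rw [h]
    exact Lconst_exp_two_div (by lia)
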